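/- Let G be a finite group with 1 ∈ CD(G). If H ∈ CD(G) and H is nontrivial, then H is not a p-group for any prime p; that is, |H| is divisible by at least two distinct primes. -/

import Mathlib

open Pointwise

/-- The Chermak-Delgado measure of a subgroup: `m_G(H) = |H| * |C_G(H)|`. -/
noncomputable def cdMeasure {G : Type*} [Group G] (H : Subgroup G) : Nat :=
  Nat.card H * Nat.card (Subgroup.centralizer (H : Set G))

/-- The Chermak-Delgado lattice of `G`: the subgroups of maximal Chermak-Delgado measure. -/
def CD (G : Type*) [Group G] : Set (Subgroup G) :=
  {H | ∀ K : Subgroup G, cdMeasure K ≤ cdMeasure H}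

namespace Subgroup

variable {G : Type*} [Group G]

theorem card_mul_card_le_card_sup_mul_card_inf [Finite G] (H K : Subgroup G) :
    Nat.card H * Nat.card K ≤ Nat.card (H ⊔ K : Subgroup G) * Nat.card (H ⊓ K : Subgroup G) := by
  have hK : Nat.card (H ⊓ K : Subgroup G) * H.relIndex K = Nat.card K := by
    rw [← inf_relIndex_right, ← relIndex_bot_left, ← relIndex_bot_left,
      relIndex_mul_relIndex _ _ _ bot_le inf_le_right]
  have hsup : Nat.card H * H.relIndex (H ⊔ K) = Nat.card (H ⊔ K : Subgroup G) := by
    rw [← relIndex_bot_left, ← relIndex_bot_left,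
      relIndex_mul_relIndex _ _ _ bot_le le_sup_left]
  have hle : H.relIndex K ≤ H.relIndex (H ⊔ K) :=
    relIndex_le_of_le_right le_sup_right index_ne_zero_of_finite
  calc Nat.card H * Nat.card K
      = Nat.card H * H.relIndex K * Nat.card (H ⊓ K : Subgroup G) := by rw [← hK]; ring
    _ ≤ Nat.card H * H.relIndex (H ⊔ K) * Nat.card (H ⊓ K : Subgroup G) := by gcongr
    _ = _ := by rw [hsup]

theorem inf_centralizer_le_centralizer_sup (H K : Subgroup G) :
    centralizer (H : Set G) ⊓ centralizer (K : Set G) ≤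
      centralizer ((H ⊔ K : Subgroup G) : Set G) := by
  rw [le_centralizer_iff, sup_le_iff, le_centralizer_iff, le_centralizer_iff (H := K)]
  exact ⟨inf_le_left, inf_le_right⟩

end Subgroup

theorem IsPGroup.exists_mem_center_of_normal {p : ℕ} [Fact p.Prime] {P : Type*} [Group P]
    [Finite P] (hP : IsPGroup p P) (N : Subgroup P) [N.Normal] (hN : N ≠ ⊥) :
    ∃ z ∈ N, z ∈ Subgroup.center P ∧ z ≠ 1 := by
  have : Nontrivial N := (Subgroup.nontrivial_iff_ne_bot N).mpr hN
  have hdvd : p ∣ Nat.card N := by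
    obtain ⟨n, hn0, hn⟩ := (hP.to_subgroup N).nontrivial_iff_card.mp inferInstance
    exact hn.symm ▸ dvd_pow_self _ hn0.ne'
  obtain ⟨z, hz, hz1⟩ :=
    (hP.of_equiv ConjAct.toConjAct).exists_fixed_point_of_prime_dvd_card_of_fixed_point N hdvd
      (a := 1) (fun g => smul_one g)
  refine ⟨z, z.2, Subgroup.mem_center_iff.mpr fun g => ?_, fun h => hz1 (Subtype.ext h.symm)⟩
  have hg := congrArg Subtype.val (hz (ConjAct.toConjAct g))
  rw [ConjAct.Subgroup.val_conj_smul, ConjAct.toConjAct_smul] at hg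
  exact mul_inv_eq_iff_eq_mul.mp hg

theorem cdMeasure_bot {G : Type*} [Group G] : cdMeasure (⊥ : Subgroup G) = Nat.card G := by
  have h : Subgroup.centralizer ((⊥ : Subgroup G) : Set G) = ⊤ := by
    rw [Subgroup.centralizer_eq_top_iff_subset]
    exact SetLike.coe_subset_coe.mpr bot_le
  rw [cdMeasure, h, Subgroup.card_bot, Subgroup.card_top, one_mul]

section ChermakDelgado

variable {G : Type*} [Group G] [Finite G]

theorem cdMeasure_pos (H : Subgroup G) : 0 < cdMeasure H :=
  Nat.mul_pos Nat.card_pos Nat.card_pos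

theorem cdMeasure_mul_le (H K : Subgroup G) :
    cdMeasure H * cdMeasure K ≤ cdMeasure (H ⊔ K) * cdMeasure (H ⊓ K) := by
  have hcard := H.card_mul_card_le_card_sup_mul_card_inf K
  have hcent := (Subgroup.centralizer (H : Set G)).card_mul_card_le_card_sup_mul_card_inf
    (Subgroup.centralizer (K : Set G))
  have hinf := Subgroup.card_le_of_le (Subgroup.inf_centralizer_le_centralizer_sup H K)
  have hsup : Nat.card (Subgroup.centralizer (H : Set G) ⊔ Subgroup.centralizer (K : Set G) :
      Subgroup G) ≤ Nat.card (Subgroup.centralizer ((H ⊓ K : Subgroup G) : Set G)) :=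
    Subgroup.card_le_of_le (sup_le
      (Subgroup.centralizer_le (SetLike.coe_subset_coe.mpr inf_le_left))
      (Subgroup.centralizer_le (SetLike.coe_subset_coe.mpr inf_le_right)))
  have h := Nat.mul_le_mul hcard (hcent.trans (Nat.mul_le_mul hsup hinf))
  unfold cdMeasure
  linarith

theorem sup_mem_CD {H K : Subgroup G} (hH : H ∈ CD G) (hK : K ∈ CD G) : H ⊔ K ∈ CD G := by
  intro L
  refine (hH L).trans (Nat.le_of_mul_le_mul_right ?_ (cdMeasure_pos K))
  exact (cdMeasure_mul_le H K).trans (Nat.mul_le_mul_left _ (hK _))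

theorem map_mem_CD {H : Subgroup G} (hH : H ∈ CD G) (f : G ≃* G) :
    H.map f.toMonoidHom ∈ CD G := by
  intro L
  have hf : Function.Injective f.toMonoidHom := f.injective
  refine (hH L).trans (Nat.mul_le_mul ?_ ?_)
  · rw [Subgroup.card_map_of_injective hf]
  · rw [← Subgroup.card_map_of_injective (K := Subgroup.centralizer (H : Set G)) hf]
    exact Subgroup.card_le_of_le (Subgroup.map_centralizer_le_centralizer_image _ _)

theorem center_eq_bot_of_bot_mem_CD (hbot : (⊥ : Subgroup G) ∈ CD G) :
    Subgroup.center G = ⊥ := by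
  have h := hbot ⊤
  rw [cdMeasure_bot, cdMeasure, Subgroup.card_top, Subgroup.coe_top,
    Subgroup.centralizer_univ] at h
  exact Subgroup.card_le_one_iff_eq_bot _ |>.mp
    (Nat.le_of_mul_le_mul_left (by simpa using h) (Nat.card_pos (α := G)))

theorem index_centralizer_of_mem_CD (hbot : (⊥ : Subgroup G) ∈ CD G) {H : Subgroup G}
    (hH : H ∈ CD G) : (Subgroup.centralizer (H : Set G)).index = Nat.card H := by
  have h : cdMeasure H = Nat.card G := by
    rw [← cdMeasure_bot]
    exact le_antisymm (hbot H) (hH ⊥)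
  rw [cdMeasure, ← Subgroup.index_mul_card (Subgroup.centralizer (H : Set G))] at h
  exact (Nat.eq_of_mul_eq_mul_right Nat.card_pos h).symm

theorem eq_bot_of_isPGroup_of_mem_CD (hbot : (⊥ : Subgroup G) ∈ CD G) {p : ℕ} [Fact p.Prime]
    {H : Subgroup G} (hH : H ∈ CD G) (hp : IsPGroup p H) : H = ⊥ := by
  obtain ⟨P, hHP⟩ := hp.exists_le_sylow
  obtain ⟨K, hHK, hK⟩ := (Set.toFinite {K : Subgroup G | K ∈ CD G ∧ K ≤ P}).exists_le_maximal
    (show H ∈ _ from ⟨hH, hHP⟩)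
  obtain ⟨hKCD, hKP⟩ := hK.prop
  have hconj : ∀ g ∈ P, ∀ k ∈ K, g * k * g⁻¹ ∈ K := by
    intro g hg k hk
    have hmem : K.map (MulAut.conj g).toMonoidHom ≤ P := by
      rintro _ ⟨x, hx, rfl⟩
      exact mul_mem (mul_mem hg (hKP hx)) (inv_mem hg)
    exact hK.le_of_ge ⟨sup_mem_CD hKCD (map_mem_CD hKCD (MulAut.conj g)), sup_le hKP hmem⟩
      le_sup_left (Subgroup.mem_sup_right ⟨k, hk, rfl⟩)
  by_contra hne
  have hKne : K ≠ ⊥ := fun h => hne (le_bot_iff.mp (h ▸ hHK))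
  have : (K.subgroupOf P).Normal := ⟨fun k hk g => hconj g g.2 k hk⟩
  obtain ⟨z, hzK, hzP, hz1⟩ := P.isPGroup'.exists_mem_center_of_normal (K.subgroupOf P)
    (fun h => hKne (by rwa [Subgroup.subgroupOf_eq_bot, disjoint_iff, inf_of_le_left hKP] at h))
  have hPz : (P : Subgroup G) ≤ Subgroup.centralizer {(z : G)} := fun g hg =>
    Subgroup.mem_centralizer_singleton_iff.mpr
      (congrArg Subtype.val (Subgroup.mem_center_iff.mp hzP ⟨g, hg⟩))
  have hCz : Subgroup.centralizer (K : Set G) ≤ Subgroup.centralizer {(z : G)} :=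
    Subgroup.centralizer_le (Set.singleton_subset_iff.mpr hzK)
  have hdvdP := Subgroup.index_dvd_of_le hPz
  have hdvdC := Subgroup.index_dvd_of_le hCz
  obtain ⟨n, hn⟩ := (IsPGroup.iff_card (G := K)).mp (P.isPGroup'.to_le hKP)
  rw [index_centralizer_of_mem_CD hbot hKCD, hn] at hdvdC
  have hcop : (p ^ n).Coprime (P : Subgroup G).index :=
    Nat.Coprime.pow_left n ((Nat.Prime.coprime_iff_not_dvd Fact.out).mpr P.not_dvd_index)
  have htop : Subgroup.centralizer {(z : G)} = ⊤ :=
    Subgroup.index_eq_one.mp (Nat.eq_one_of_dvd_coprimes hcop hdvdC hdvdP)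
  have hcenter := Set.singleton_subset_iff.mp (Subgroup.centralizer_eq_top_iff_subset.mp htop)
  rw [center_eq_bot_of_bot_mem_CD hbot] at hcenter
  exact hz1 (Subtype.ext (Subgroup.mem_bot.mp hcenter))

end ChermakDelgado

theorem stmt16 {G : Type*} [Group G] [Fintype G]
    (hbot : (⊥ : Subgroup G) ∈ CD G)
    (H : Subgroup G) (hH : H ∈ CD G) (hne : H ≠ ⊥) :
    ∃ p q : Nat, p.Prime ∧ q.Prime ∧ p ≠ q ∧ p ∣ Nat.card H ∧ q ∣ Nat.card H := by
  obtain ⟨p, hp, hpH⟩ := Nat.exists_prime_and_dvd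
    (fun h => hne (Subgroup.card_eq_one.mp h))
  by_contra hcon
  have : Fact p.Prime := ⟨hp⟩
  refine hne (eq_bot_of_isPGroup_of_mem_CD hbot hH (p := p) (IsPGroup.of_card
    (Nat.eq_prime_pow_of_unique_prime_dvd Nat.card_pos.ne' fun {q} hq hqH => ?_)))
  by_contra hqp
  exact hcon ⟨p, q, hp, hq, Ne.symm hqp, hpH, hqH⟩
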